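/- arXiv:2507.06032 — 2 statements merged into one kernel-verified Lean document; each statement's English description precedes it below -/
import Mathlib

section
/- There is a constant C > 0 such that the following holds. For every abstract online covering problem, every function ρ : ℕ → ℝ with ρ(t) ≥ 1 for all t, ρ nondecreasing and ρ(2t) ≤ 2·ρ(t) for all t ≥ 1, every ρ-competitive deterministic online algorithm ALG, and every prediction X̂ : Finset X, there exists a deterministic online algorithm B (prefix-monotone and feasible) such that for every duplicate-free request sequence σ, c(B σ) ≤ C · ρ(η(σ)) · opt(σ.toFinset). -/
open Finset

/-- An abstract online covering problem. -/
structure CoveringProblem (X S : Type) [DecidableEq X] [Fintype S] [DecidableEq S] where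
  cost : S → ℝ
  cost_nonneg : ∀ s, 0 ≤ cost s
  Feas : Finset X → Finset S → Prop
  feas_union : ∀ A₁ T₁ A₂ T₂, Feas A₁ T₁ → Feas A₂ T₂ → Feas (A₁ ∪ A₂) (T₁ ∪ T₂)
  feas_mono : ∀ A T A' T', Feas A T → A' ⊆ A → T ⊆ T' → Feas A' T'
  feas_univ : ∀ A, Feas A Finset.univ

variable {X S : Type} [DecidableEq X] [Fintype S] [DecidableEq S]

/-- Cost of a finite set of solution items. -/
def CoveringProblem.setCost (P : CoveringProblem X S) (T : Finset S) : ℝ :=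
  ∑ s ∈ T, P.cost s

/-- Cost of a cheapest feasible solution for a finite request set. -/
noncomputable def CoveringProblem.optCost (P : CoveringProblem X S) (A : Finset X) : ℝ :=
  sInf {r : ℝ | ∃ T : Finset S, P.Feas A T ∧ r = P.setCost T}

/-- A deterministic online algorithm: prefix-monotone (irrevocable purchases) and feasible. -/
def CoveringProblem.IsOnlineAlg (P : CoveringProblem X S) (ALG : List X → Finset S) : Prop :=
  (∀ (σ : List X) (x : X), ALG σ ⊆ ALG (σ ++ [x])) ∧
  ∀ σ : List X, P.Feas σ.toFinset (ALG σ)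

/-- ρ-competitiveness on duplicate-free request sequences. -/
def CoveringProblem.IsCompetitive (P : CoveringProblem X S) (ρ : ℕ → ℝ)
    (ALG : List X → Finset S) : Prop :=
  ∀ σ : List X, σ.Nodup → P.setCost (ALG σ) ≤ ρ σ.length * P.optCost σ.toFinset

/-- The prediction error η(σ) = min(|Xσ|, |Xσ \ X̂| + |X̂ \ Xσ|). -/
def predErr (Xhat : Finset X) (σ : List X) : ℕ :=
  min σ.toFinset.card ((σ.toFinset \ Xhat).card + (Xhat \ σ.toFinset).card)


namespace CoveringProblem

theorem setCost_mono (P : CoveringProblem X S) {T T' : Finset S} (h : T ⊆ T') :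
    P.setCost T ≤ P.setCost T' :=
  Finset.sum_le_sum_of_subset_of_nonneg h (fun s _ _ => P.cost_nonneg s)

theorem setCost_nonneg (P : CoveringProblem X S) (T : Finset S) : 0 ≤ P.setCost T :=
  Finset.sum_nonneg (fun s _ => P.cost_nonneg s)

theorem setCost_union (P : CoveringProblem X S) (T T' : Finset S) :
    P.setCost (T ∪ T') ≤ P.setCost T + P.setCost T' := by
  unfold setCost
  rw [← Finset.sum_union_inter]
  have := Finset.sum_nonneg (s := T ∩ T') (fun s _ => P.cost_nonneg s)
  linarith

theorem setCost_biUnion (P : CoveringProblem X S) (n : ℕ) (T : ℕ → Finset S) :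
    P.setCost ((Finset.range n).biUnion T) ≤ ∑ i ∈ Finset.range n, P.setCost (T i) := by
  induction n with
  | zero => simp [setCost]
  | succ n ih =>
    rw [Finset.sum_range_succ, Finset.range_add_one, Finset.biUnion_insert]
    have := P.setCost_union (T n) ((Finset.range n).biUnion T)
    linarith

theorem opt_attained (P : CoveringProblem X S) (A : Finset X) :
    ∃ T, P.Feas A T ∧ P.optCost A = P.setCost T := by
  have hne : {r : ℝ | ∃ T : Finset S, P.Feas A T ∧ r = P.setCost T}.Nonempty :=
    ⟨_, Finset.univ, P.feas_univ A, rfl⟩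
  have hfin : {r : ℝ | ∃ T : Finset S, P.Feas A T ∧ r = P.setCost T}.Finite := by
    apply (Set.finite_range P.setCost).subset
    rintro r ⟨T, -, rfl⟩
    exact ⟨T, rfl⟩
  exact hne.csInf_mem hfin

theorem opt_le (P : CoveringProblem X S) {A : Finset X} {T : Finset S} (h : P.Feas A T) :
    P.optCost A ≤ P.setCost T := by
  apply csInf_le
  · refine ⟨0, ?_⟩
    rintro r ⟨T, -, rfl⟩
    exact P.setCost_nonneg T
  · exact ⟨T, h, rfl⟩

theorem feas_of_singletons (P : CoveringProblem X S) {T : Finset S} (h0 : P.Feas ∅ T)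
    (A : Finset X) (h : ∀ x ∈ A, P.Feas {x} T) : P.Feas A T := by
  induction A using Finset.induction_on with
  | empty => exact h0
  | insert a A ha ih =>
    have h1 := ih (fun x hx => h x (Finset.mem_insert_of_mem hx))
    have h2 := P.feas_union _ _ _ _ (h a (Finset.mem_insert_self _ _)) h1
    rwa [Finset.union_self, ← Finset.insert_eq] at h2

theorem exists_beta (P : CoveringProblem X S) :
    ∃ β : ℝ, 0 < β ∧ ∀ T, 0 < P.setCost T → β ≤ P.setCost T := by
  classical
  by_cases h : ((Finset.univ : Finset (Finset S)).filter (fun T => 0 < P.setCost T)).Nonempty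
  · obtain ⟨T, hT, hmin⟩ := Finset.exists_min_image _ P.setCost h
    refine ⟨P.setCost T, (Finset.mem_filter.1 hT).2, fun T' h' => hmin T' (by simpa using h')⟩
  · refine ⟨1, one_pos, fun T hT => (h ⟨T, by simpa using hT⟩).elim⟩

open Classical in
theorem exists_partial (P : CoveringProblem X S) (Xhat : Finset X) (b : ℝ) (hb : 0 ≤ b) :
    ∃ T, P.setCost T ≤ b ∧ ∀ T', P.setCost T' ≤ b →
      (Xhat.filter (fun x => P.Feas {x} T')).card ≤ (Xhat.filter (fun x => P.Feas {x} T)).card := by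
  have h : ((Finset.univ : Finset (Finset S)).filter (fun T => P.setCost T ≤ b)).Nonempty :=
    ⟨∅, Finset.mem_filter.2 ⟨Finset.mem_univ _, by simpa [setCost] using hb⟩⟩
  obtain ⟨T, hT, hmax⟩ := Finset.exists_max_image _
    (fun T => (Xhat.filter (fun x => P.Feas {x} T)).card) h
  exact ⟨T, (Finset.mem_filter.1 hT).2, fun T' h' => hmax T' (by simpa using h')⟩

open Classical in
theorem prefix_cost (P : CoveringProblem X S) (F : List X → Finset S)
    (hF : ∀ σ x, F σ ⊆ F (σ ++ [x])) (b : ℝ) (hb : 0 ≤ b) (σ : List X) :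
    P.setCost (Finset.univ.filter
      (fun s => ∃ τ, τ <+: σ ∧ P.setCost (F τ) ≤ b ∧ s ∈ F τ)) ≤ b := by
  have hpre : ∀ τ σ, τ <+: σ → F τ ⊆ F σ := by
    rintro τ σ ⟨ρ, rfl⟩
    induction ρ using List.reverseRecOn with
    | nil => simp
    | append_singleton l a ih =>
      rw [← List.append_assoc]
      exact ih.trans (hF _ _)
  induction σ using List.reverseRecOn with
  | nil =>
    by_cases h : P.setCost (F []) ≤ b
    · refine (P.setCost_mono ?_).trans h
      intro s hs
      simpa [h] using hs
    · rw [Finset.filter_eq_empty_iff.2]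
      · simpa [setCost] using hb
      · rintro s - ⟨τ, h1, h2, -⟩
        rw [List.prefix_nil.1 h1] at h2
        exact h h2
  | append_singleton l a ih =>
    by_cases h : P.setCost (F (l ++ [a])) ≤ b
    · refine (P.setCost_mono ?_).trans h
      intro s hs
      obtain ⟨τ, h1, -, h3⟩ := (Finset.mem_filter.1 hs).2
      exact hpre _ _ h1 h3
    · refine (P.setCost_mono ?_).trans ih
      intro s hs
      obtain ⟨τ, h1, h2, h3⟩ := (Finset.mem_filter.1 hs).2
      refine Finset.mem_filter.2 ⟨Finset.mem_univ _, τ, ?_, h2, h3⟩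
      rcases List.prefix_concat_iff.1 h1 with h4 | h4
      · exact (h (h4 ▸ h2)).elim
      · exact h4

end CoveringProblem

/-- Budget of level i. -/
def budget (β : ℝ) : ℕ → ℝ
  | 0 => 0
  | (i + 1) => β * 2 ^ i

theorem budget_nonneg {β : ℝ} (h : 0 < β) (i : ℕ) : 0 ≤ budget β i := by
  cases i <;> simp [budget]; positivity

theorem budget_sum (β : ℝ) (n : ℕ) :
    ∑ i ∈ Finset.range (n + 1), 2 * budget β i = 2 * (β * 2 ^ n - β) := by
  induction n with
  | zero => simp [budget]
  | succ n ih =>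
    rw [Finset.sum_range_succ, ih]
    simp only [budget]
    ring

theorem stmt0 :
    ∃ C : ℝ, 0 < C ∧
      ∀ (X S : Type) [DecidableEq X] [Fintype S] [DecidableEq S]
        (P : CoveringProblem X S) (ρ : ℕ → ℝ),
        (∀ t, 1 ≤ ρ t) → Monotone ρ → (∀ t, 1 ≤ t → ρ (2 * t) ≤ 2 * ρ t) →
        ∀ ALG : List X → Finset S, P.IsOnlineAlg ALG → P.IsCompetitive ρ ALG →
        ∀ Xhat : Finset X,
          ∃ B : List X → Finset S, P.IsOnlineAlg B ∧
            ∀ σ : List X, σ.Nodup →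
              P.setCost (B σ) ≤ C * ρ (predErr Xhat σ) * P.optCost σ.toFinset := by
  classical
  refine ⟨8, by norm_num, ?_⟩
  intro X S _ _ _ P ρ hρ1 hρm _ ALG hALG hcomp Xhat
  obtain ⟨β, hβ, hβmin⟩ := P.exists_beta
  have hb := budget_nonneg hβ
  choose T hTc hTmax using fun i => P.exists_partial Xhat (budget β i) (hb i)
  let f : ℕ → List X → List X := fun i σ => σ.filter (fun x => ¬ P.Feas {x} (T i))
  have hmono : ∀ i σ x, ALG (f i σ) ⊆ ALG (f i (σ ++ [x])) := by
    intro i σ x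
    by_cases h : P.Feas {x} (T i)
    · simp [f, List.filter_append, h]
    · simpa [f, List.filter_append, h] using hALG.1 _ x
  have hex : ∀ σ, ∃ i, P.setCost (ALG (f i σ)) ≤ budget β i := by
    intro σ
    obtain ⟨n, hn⟩ := pow_unbounded_of_one_lt (P.setCost Finset.univ / β) (one_lt_two)
    refine ⟨n + 1, (P.setCost_mono (Finset.subset_univ _)).trans ?_⟩
    rw [div_lt_iff₀ hβ] at hn
    simp only [budget]
    linarith
  let L : List X → ℕ := fun σ => Nat.find (hex σ)
  have hL : ∀ σ, P.setCost (ALG (f (L σ) σ)) ≤ budget β (L σ) := fun σ => Nat.find_spec (hex σ)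
  have hLmono : ∀ σ x, L σ ≤ L (σ ++ [x]) := fun σ x =>
    Nat.find_min' (hex σ) ((P.setCost_mono (hmono _ σ x)).trans (hL (σ ++ [x])))
  let U : ℕ → List X → Finset S := fun i σ => Finset.univ.filter
      (fun s => ∃ τ, τ <+: σ ∧ P.setCost (ALG (f i τ)) ≤ budget β i ∧ s ∈ ALG (f i τ))
  have hU : ∀ i σ, P.setCost (U i σ) ≤ budget β i := fun i σ =>
    P.prefix_cost (fun τ => ALG (f i τ)) (hmono i) _ (hb i) σ
  let B : List X → Finset S := fun σ => (Finset.range (L σ + 1)).biUnion (fun i => T i ∪ U i σ)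
  refine ⟨B, ⟨?_, ?_⟩, ?_⟩
  · intro σ x
    refine Finset.biUnion_subset_biUnion_of_subset_left _ ?_ |>.trans
      (Finset.biUnion_mono (fun i _ => Finset.union_subset_union_right ?_))
    · intro i hi
      have := hLmono σ x
      simp only [Finset.mem_range] at *
      omega
    · intro s hs
      obtain ⟨τ, h1, h2, h3⟩ := (Finset.mem_filter.1 hs).2
      exact Finset.mem_filter.2 ⟨Finset.mem_univ _, τ, h1.trans (List.prefix_append _ _), h2, h3⟩
  · intro σ
    have hTB : T (L σ) ∪ U (L σ) σ ⊆ B σ :=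
      Finset.subset_biUnion_of_mem (fun i => T i ∪ U i σ) (by simp)
    have hAB : ALG (f (L σ) σ) ⊆ B σ := by
      refine Finset.Subset.trans ?_ (Finset.subset_union_right.trans hTB)
      intro s hs
      exact Finset.mem_filter.2 ⟨Finset.mem_univ _, σ, List.prefix_rfl, hL σ, hs⟩
    have hfe := hALG.2 (f (L σ) σ)
    refine P.feas_of_singletons (P.feas_mono _ _ _ _ hfe (Finset.empty_subset _) hAB) _ ?_
    intro x hx
    by_cases h : P.Feas {x} (T (L σ))
    · exact P.feas_mono _ _ _ _ h subset_rfl (Finset.subset_union_left.trans hTB)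
    · refine P.feas_mono _ _ _ _ hfe ?_ hAB
      simp only [Finset.singleton_subset_iff, List.mem_toFinset, f, List.mem_filter]
      exact ⟨by simpa using hx, by simpa using h⟩
  · intro σ hσ
    obtain ⟨Ts, hTs, hopt⟩ := P.opt_attained σ.toFinset
    have hopt0 : 0 ≤ P.optCost σ.toFinset := hopt ▸ P.setCost_nonneg Ts
    have hρ := hρ1 (predErr Xhat σ)
    have hcost : P.setCost (B σ) ≤ 2 * (β * 2 ^ (L σ) - β) := by
      rw [← budget_sum]
      refine (P.setCost_biUnion _ _).trans (Finset.sum_le_sum fun i _ => ?_)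
      have := P.setCost_union (T i) (U i σ)
      linarith [hTc i, hU i σ]
    -- key bound
    have key : ∀ i, P.optCost σ.toFinset ≤ budget β i →
        P.setCost (ALG (f i σ)) ≤ ρ (predErr Xhat σ) * P.optCost σ.toFinset := by
      intro i hi
      have hnd : (f i σ).Nodup := hσ.filter _
      have hsub : (f i σ).toFinset ⊆ σ.toFinset := by
        intro x hx
        simp only [f, List.mem_toFinset, List.mem_filter] at hx ⊢
        exact hx.1
      have h1 : P.optCost (f i σ).toFinset ≤ P.optCost σ.toFinset := by
        rw [hopt]
        exact P.opt_le (P.feas_mono _ _ _ _ hTs hsub subset_rfl)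
      have hcard : (f i σ).length = (f i σ).toFinset.card := (List.toFinset_card_of_nodup hnd).symm
      have h2 : (f i σ).length ≤ predErr Xhat σ := by
        rw [hcard]
        refine le_min (Finset.card_le_card hsub) ?_
        have hc := hTmax i Ts (hopt ▸ hi)
        have hc2 : (Xhat ∩ σ.toFinset).card ≤ (Xhat.filter (fun x => P.Feas {x} Ts)).card := by
          apply Finset.card_le_card
          intro x hx
          rw [Finset.mem_inter] at hx
          exact Finset.mem_filter.2 ⟨hx.1, P.feas_mono _ _ _ _ hTs (by simpa using hx.2) subset_rfl⟩
        have hc3 := Finset.card_filter_add_card_filter_not (s := Xhat) (fun x => P.Feas {x} (T i))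
        have hc4 := Finset.card_inter_add_card_sdiff Xhat σ.toFinset
        have hc5 : (f i σ).toFinset ⊆
            (σ.toFinset \ Xhat) ∪ Xhat.filter (fun x => ¬ P.Feas {x} (T i)) := by
          intro x hx
          simp only [f, List.mem_toFinset, List.mem_filter, decide_eq_true_eq] at hx
          simp only [Finset.mem_union, Finset.mem_sdiff, Finset.mem_filter, List.mem_toFinset]
          tauto
        have hc6 := (Finset.card_le_card hc5).trans (Finset.card_union_le _ _)
        omega
      exact (hcomp _ hnd).trans (mul_le_mul (hρm h2) h1
        (by obtain ⟨T', -, h'⟩ := P.opt_attained (f i σ).toFinset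
            exact h' ▸ P.setCost_nonneg T') (by linarith))
    have hρo : P.optCost σ.toFinset ≤ ρ (predErr Xhat σ) * P.optCost σ.toFinset := by
      nlinarith
    rcases hm : L σ with _ | m
    · rw [hm] at hcost
      simp at hcost
      nlinarith
    · have hfail : budget β m < P.setCost (ALG (f m σ)) := by
        have := Nat.find_min (hex σ) (m := m) (by change m < L σ; omega)
        exact not_le.1 this
      have hbm : budget β m < ρ (predErr Xhat σ) * P.optCost σ.toFinset := by
        by_cases h : P.optCost σ.toFinset ≤ budget β m
        · exact hfail.trans_le (key m h)
        · exact (not_le.1 h).trans_le hρo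
      rw [hm] at hcost
      rcases m with _ | m
      · have hpos : 0 < P.optCost σ.toFinset := by
          simp only [budget] at hbm
          by_contra h
          have : P.optCost σ.toFinset = 0 := by linarith
          simp [this] at hbm
        have := hβmin Ts (hopt ▸ hpos)
        rw [← hopt] at this
        simp only [zero_add, pow_one] at hcost
        nlinarith
      · simp only [budget] at hbm
        have : β * 2 ^ (m + 1 + 1) = 4 * (β * 2 ^ m) := by ring
        rw [this] at hcost
        nlinarith
end

section
/- There is a constant C > 0 such that the following holds. For every abstract online covering problem that is (α, γ)-decomposable (with reals α ≥ 1, γ ≥ 1), every function ρ : ℕ → ℝ with ρ(t) ≥ 1 for all t, ρ nondecreasing and ρ(2t) ≤ 2·ρ(t), every ρ-competitive deterministic online algorithm, and every prediction X̂ : Finset X, there exists a deterministic online algorithm B such that for every duplicate-free request sequence σ with k := σ.length ≥ 1, c(B σ) ≤ C · ( ρ(η(σ)) + g_{α,γ}(k) ) · opt(σ.toFinset). -/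
open Finset

variable {X S : Type} [DecidableEq X] [Fintype S] [DecidableEq S]

/-- `m_j(R)`: minimum of `opt(A)` over subsets `A ⊆ R` of cardinality `j`. -/
noncomputable def CoveringProblem.mCost (P : CoveringProblem X S) (R : Finset X) (j : ℕ) : ℝ :=
  sInf {r : ℝ | ∃ A : Finset X, A ⊆ R ∧ A.card = j ∧ r = P.optCost A}

/-- (α, γ)-decomposability. -/
def CoveringProblem.Decomposable (P : CoveringProblem X S) (α γ : ℝ) : Prop :=
  ∀ (R : Finset X) (i : ℕ), 1 ≤ i → i ≤ R.card →
    ∃ (B : Finset X) (T : Finset S), B ⊆ R ∧ (i : ℝ) / γ ≤ (B.card : ℝ) ∧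
      P.Feas B T ∧ P.setCost T ≤ α * P.mCost R i

/-- `g_{α,γ}(t)`. -/
noncomputable def gFun (α γ : ℝ) (t : ℕ) : ℝ :=
  if γ = 1 then α else α * (1 + Real.log t / Real.log (γ / (γ - 1)))

namespace CoveringProblem

theorem optCost_nonneg (P : CoveringProblem X S) (A : Finset X) : 0 ≤ P.optCost A := by
  apply Real.sInf_nonneg
  rintro r ⟨T, -, rfl⟩
  exact P.setCost_nonneg T

theorem optCost_mono (P : CoveringProblem X S) {A A' : Finset X} (h : A ⊆ A') :
    P.optCost A ≤ P.optCost A' := by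
  apply csInf_le_csInf
  · refine ⟨0, ?_⟩
    rintro r ⟨T, -, rfl⟩
    exact P.setCost_nonneg T
  · exact ⟨_, univ, P.feas_univ _, rfl⟩
  · rintro r ⟨T, hT, rfl⟩
    exact ⟨T, P.feas_mono _ _ _ _ hT h (Finset.Subset.refl _), rfl⟩

theorem mCost_le (P : CoveringProblem X S) {A R : Finset X} (h : A ⊆ R) :
    P.mCost R A.card ≤ P.optCost A := by
  apply csInf_le
  · refine ⟨0, ?_⟩
    rintro r ⟨T, -, -, rfl⟩
    exact P.optCost_nonneg T
  · exact ⟨A, h, rfl, rfl⟩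

/-- Relative feasibility of a partial solution. -/
def Good (P : CoveringProblem X S) (D : Finset X) (T : Finset S) : Prop :=
  ∀ A U, P.Feas A U → P.Feas (A ∪ D) (U ∪ T)

theorem good_empty (P : CoveringProblem X S) : P.Good ∅ ∅ := by
  intro A U h; simpa using h

theorem Good.union {P : CoveringProblem X S} {D : Finset X} {T : Finset S} (h : P.Good D T)
    {B : Finset X} {U : Finset S} (hB : P.Feas B U) : P.Good (D ∪ B) (T ∪ U) := by
  intro A V hA
  have := P.feas_union _ _ _ _ (h A V hA) hB
  rwa [Finset.union_assoc, Finset.union_assoc] at this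

theorem decomp_iter (P : CoveringProblem X S) {α γ : ℝ} (hα : 1 ≤ α) (hγ : 1 ≤ γ)
    (hd : P.Decomposable α γ) (R Y : Finset X) (L : ℕ) :
    ∃ D T, D ⊆ R ∧ P.Good D T ∧ P.setCost T ≤ L * (α * P.optCost Y) ∧
      ((R \ D).card : ℝ) ≤ (R \ Y).card + (R ∩ Y).card * (1 - 1 / γ) ^ L := by
  have hq : 0 ≤ 1 - 1 / γ := by
    have : 1 / γ ≤ 1 := by rw [div_le_one (by linarith)]; exact hγ
    linarith
  induction L with
  | zero =>
    refine ⟨∅, ∅, by simp, P.good_empty, by simp [setCost], ?_⟩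
    have := Finset.card_sdiff_add_card_inter R Y
    simp only [sdiff_empty, pow_zero, mul_one]
    rw [← this]; push_cast; rfl
  | succ L ih =>
    obtain ⟨D, T, hDR, hG, hc, hn⟩ := ih
    have ho : 0 ≤ α * P.optCost Y := mul_nonneg (by linarith) (P.optCost_nonneg Y)
    rcases le_or_gt (R \ D).card (R \ Y).card with hle | hlt
    · refine ⟨D, T, hDR, hG, ?_, ?_⟩
      · push_cast; nlinarith
      · have h1 : ((R \ D).card : ℝ) ≤ (R \ Y).card := by exact_mod_cast hle
        have h2 : 0 ≤ ((R ∩ Y).card : ℝ) * (1 - 1 / γ) ^ (L + 1) := by positivity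
        linarith
    · obtain ⟨i, hi⟩ := Nat.exists_eq_add_of_lt hlt
      have hcard : i + 1 ≤ ((R \ D) ∩ Y).card := by
        have e1 := Finset.card_sdiff_add_card_inter (R \ D) Y
        have e2 : ((R \ D) \ Y).card ≤ (R \ Y).card :=
          Finset.card_le_card (Finset.sdiff_subset_sdiff Finset.sdiff_subset (Finset.Subset.refl _))
        omega
      obtain ⟨A, hA, hAc⟩ := Finset.exists_subset_card_eq hcard
      obtain ⟨B, U, hBR, hBc, hBU, hU⟩ := hd (R \ D) (i + 1) (by omega) (by omega)
      have hm : P.mCost (R \ D) (i + 1) ≤ P.optCost Y := by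
        rw [← hAc]
        exact (P.mCost_le (hA.trans Finset.inter_subset_left)).trans
          (P.optCost_mono (hA.trans Finset.inter_subset_right))
      refine ⟨D ∪ B, T ∪ U, Finset.union_subset hDR (hBR.trans Finset.sdiff_subset),
        hG.union hBU, ?_, ?_⟩
      · have h1 := P.setCost_union T U
        have h2 : α * P.mCost (R \ D) (i + 1) ≤ α * P.optCost Y :=
          mul_le_mul_of_nonneg_left hm (by linarith)
        push_cast; linarith
      · have e : R \ (D ∪ B) = (R \ D) \ B := by
          ext x; simp only [mem_sdiff, mem_union]; tauto
        rw [e]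
        have e3 : (((R \ D) \ B).card : ℝ) + B.card = (R \ D).card := by
          exact_mod_cast Finset.card_sdiff_add_card_eq_card hBR
        have hi' : ((R \ D).card : ℝ) = (R \ Y).card + i + 1 := by exact_mod_cast hi
        have h4 : (i : ℝ) + 1 ≤ (R ∩ Y).card * (1 - 1 / γ) ^ L := by linarith
        have h5 := mul_le_mul_of_nonneg_right h4 hq
        push_cast at hBc
        have h6 : ((i : ℝ) + 1) / γ = (i + 1) * (1 / γ) := by ring
        rw [pow_succ, ← mul_assoc]
        nlinarith

theorem decomp (P : CoveringProblem X S) {α γ : ℝ} (hα : 1 ≤ α) (hγ : 1 ≤ γ)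
    (hd : P.Decomposable α γ) (R Y : Finset X) (hk : 1 ≤ Y.card) :
    ∃ D T, D ⊆ R ∧ P.Good D T ∧ P.setCost T ≤ gFun α γ Y.card * P.optCost Y ∧
      (R \ D).card ≤ (R \ Y).card := by
  have ho : 0 ≤ α * P.optCost Y := mul_nonneg (by linarith) (P.optCost_nonneg Y)
  by_cases h1 : γ = 1
  · obtain ⟨D, T, a, b, c, d⟩ := P.decomp_iter hα hγ hd R Y 1
    refine ⟨D, T, a, b, ?_, ?_⟩
    · simpa [gFun, h1] using c
    · subst h1
      simp only [div_one, sub_self, pow_one, mul_zero, add_zero] at d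
      exact_mod_cast d
  · have hγ1 : 1 < γ := lt_of_le_of_ne hγ (Ne.symm h1)
    set q := γ / (γ - 1) with hq
    have hq1 : 1 < q := by rw [hq, lt_div_iff₀ (by linarith)]; linarith
    have hlq : 0 < Real.log q := Real.log_pos hq1
    have hk' : (1 : ℝ) ≤ Y.card := by exact_mod_cast hk
    have hlk : 0 ≤ Real.log Y.card := Real.log_nonneg hk'
    set L := ⌊Real.log Y.card / Real.log q⌋₊ + 1 with hL
    have hL1 : Real.log Y.card / Real.log q < L := by
      rw [hL]; push_cast; exact Nat.lt_floor_add_one _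
    have hL2 : (L : ℝ) ≤ 1 + Real.log Y.card / Real.log q := by
      rw [hL]; push_cast
      have := Nat.floor_le (div_nonneg hlk hlq.le)
      linarith
    obtain ⟨D, T, a, b, c, d⟩ := P.decomp_iter hα hγ hd R Y L
    refine ⟨D, T, a, b, ?_, ?_⟩
    · rw [gFun, if_neg h1]
      have := mul_le_mul_of_nonneg_right hL2 ho
      rw [← hq]
      linarith
    · have hpow : (Y.card : ℝ) < q ^ L := by
        rw [div_lt_iff₀ hlq] at hL1
        have : Real.log Y.card < Real.log (q ^ L) := by rw [Real.log_pow]; exact hL1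
        exact (Real.log_lt_log_iff (by linarith) (by positivity)).1 this
      have hinv : 1 - 1 / γ = q⁻¹ := by
        rw [hq, inv_div]; field_simp
      have hle : ((R ∩ Y).card : ℝ) ≤ Y.card := by
        exact_mod_cast Finset.card_le_card Finset.inter_subset_right
      have : ((R ∩ Y).card : ℝ) * (1 - 1 / γ) ^ L < 1 := by
        rw [hinv, inv_pow, ← div_eq_mul_inv, div_lt_one (by positivity)]
        linarith
      have h3 : ((R \ D).card : ℝ) < ((R \ Y).card + 1 : ℕ) := by push_cast; linarith
      have := Nat.cast_lt.1 h3
      omega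

theorem exists_max (P : CoveringProblem X S) (R : Finset X) (b : ℝ) (hb : 0 ≤ b) :
    ∃ D T, D ⊆ R ∧ P.Good D T ∧ P.setCost T ≤ b ∧
      ∀ D' T', D' ⊆ R → P.Good D' T' → P.setCost T' ≤ b → (R \ D).card ≤ (R \ D').card := by
  classical
  have hne : (R.powerset.filter fun D => ∃ T, P.Good D T ∧ P.setCost T ≤ b).Nonempty :=
    ⟨∅, by simp only [mem_filter, empty_mem_powerset, true_and]
           exact ⟨∅, P.good_empty, by simpa [setCost] using hb⟩⟩
  obtain ⟨D, hD, hmin⟩ := Finset.exists_min_image _ (fun D => (R \ D).card) hne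
  simp only [mem_filter, mem_powerset] at hD hmin
  obtain ⟨hDR, T, hG, hc⟩ := hD
  exact ⟨D, T, hDR, hG, hc, fun D' T' h1 h2 h3 => hmin D' ⟨h1, T', h2, h3⟩⟩

theorem exists_gap (P : CoveringProblem X S) :
    ∃ δ : ℝ, 0 < δ ∧ ∀ T, P.setCost T ≤ 2 * δ → P.setCost T = 0 := by
  classical
  by_cases h : ((univ : Finset (Finset S)).filter fun T => 0 < P.setCost T).Nonempty
  · obtain ⟨T, hT, hmin⟩ := Finset.exists_min_image _ (fun T => P.setCost T) h
    simp only [mem_filter, mem_univ, true_and] at hT hmin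
    refine ⟨P.setCost T / 4, by linarith, fun U hU => ?_⟩
    by_contra hne
    have := hmin U (lt_of_le_of_ne (P.setCost_nonneg U) (Ne.symm hne))
    linarith
  · refine ⟨1, one_pos, fun U _ => ?_⟩
    by_contra hne
    exact h ⟨U, by simpa using lt_of_le_of_ne (P.setCost_nonneg U) (Ne.symm hne)⟩

theorem IsOnlineAlg.mono {P : CoveringProblem X S} {ALG : List X → Finset S}
    (h : P.IsOnlineAlg ALG) (σ τ : List X) : ALG σ ⊆ ALG (σ ++ τ) := by
  induction τ using List.reverseRecOn with
  | nil => simp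
  | append_singleton τ x ih =>
    rw [← List.append_assoc]
    exact ih.trans (h.1 _ _)

theorem setCost_biUnion_le (P : CoveringProblem X S) (δ : ℝ) (F : ℕ → Finset S)
    (hF : ∀ i, P.setCost (F i) ≤ 2 * (δ * 2 ^ i)) (hδ : 0 < δ) (n : ℕ) :
    P.setCost ((range (n + 1)).biUnion F) ≤ 4 * (δ * 2 ^ n) := by
  induction n with
  | zero => have := hF 0; simp at this ⊢; linarith
  | succ n ih =>
    rw [Finset.range_add_one, Finset.biUnion_insert]
    have := P.setCost_union (F (n + 1)) ((range (n + 1)).biUnion F)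
    have := hF (n + 1)
    have e : δ * 2 ^ (n + 1) = 2 * (δ * 2 ^ n) := by ring
    rw [e] at this ⊢
    linarith

/-- The combined algorithm. -/
theorem combine (P : CoveringProblem X S) (δ : ℝ) (hδ : 0 < δ)
    (A : ℕ → List X → Finset S) (T : ℕ → Finset S)
    (hmono : ∀ i σ x, A i σ ⊆ A i (σ ++ [x]))
    (hfeas : ∀ i σ, P.Feas σ.toFinset (A i σ ∪ T i))
    (hT : ∀ i, P.setCost (T i) ≤ δ * 2 ^ i) :
    ∃ B : List X → Finset S, P.IsOnlineAlg B ∧ ∀ σ,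
      P.setCost (B σ) ≤ 2 * δ ∨
      ∃ i, δ * 2 ^ i < P.setCost (A i σ) ∧ P.setCost (B σ) ≤ 8 * (δ * 2 ^ i) := by
  classical
  have hex : ∀ σ, ∃ i, P.setCost (A i σ) ≤ δ * 2 ^ i := by
    intro σ
    obtain ⟨n, hn⟩ := pow_unbounded_of_one_lt (P.setCost univ / δ) (one_lt_two (α := ℝ))
    refine ⟨n, (P.setCost_mono (subset_univ _)).trans ?_⟩
    rw [div_lt_iff₀ hδ] at hn
    linarith
  let j : List X → ℕ := fun σ => Nat.find (hex σ)
  have hj : ∀ σ, P.setCost (A (j σ) σ) ≤ δ * 2 ^ (j σ) := fun σ => Nat.find_spec (hex σ)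
  have hjm : ∀ σ i, i < j σ → δ * 2 ^ i < P.setCost (A i σ) := fun σ i hi =>
    not_le.1 (Nat.find_min (hex σ) hi)
  have hApp : ∀ i σ τ, A i σ ⊆ A i (σ ++ τ) := by
    intro i σ τ
    induction τ using List.reverseRecOn with
    | nil => simp
    | append_singleton τ x ih =>
      rw [← List.append_assoc]
      exact ih.trans (hmono _ _ _)
  have hjmono : ∀ σ τ, τ <+: σ → j τ ≤ j σ := by
    rintro σ τ ⟨ν, rfl⟩
    by_contra hlt
    have h1 := hjm τ _ (not_le.1 hlt)
    have h2 := hj (τ ++ ν)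
    have h3 := P.setCost_mono (hApp (j (τ ++ ν)) τ ν)
    linarith
  let E : ℕ → List X → Finset S := fun i σ =>
    univ.filter fun s => ∃ τ, τ <+: σ ∧ j τ = i ∧ s ∈ A i τ
  have hE : ∀ i σ, P.setCost (E i σ) ≤ δ * 2 ^ i := by
    intro i σ
    induction σ using List.reverseRecOn with
    | nil =>
      by_cases h : j [] = i
      · refine (P.setCost_mono (T' := A i []) ?_).trans (h ▸ hj [])
        intro s hs
        simp only [E, mem_filter, mem_univ, true_and, List.prefix_nil] at hs
        obtain ⟨τ, rfl, -, h⟩ := hs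
        exact h
      · have : E i [] = ∅ := by
          ext s
          simp [E, h]
        rw [this]
        simp only [setCost, sum_empty]
        positivity
    | append_singleton σ x ih =>
      by_cases h : j (σ ++ [x]) = i
      · refine (P.setCost_mono (T' := A i (σ ++ [x])) ?_).trans (h ▸ hj (σ ++ [x]))
        intro s hs
        simp only [E, mem_filter, mem_univ, true_and] at hs
        obtain ⟨τ, ⟨ν, hν⟩, -, h⟩ := hs
        rw [← hν]
        exact hApp _ _ _ h
      · refine (P.setCost_mono ?_).trans ih
        intro s hs
        simp only [E, mem_filter, mem_univ, true_and] at hs ⊢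
        obtain ⟨τ, hp, hi, hs⟩ := hs
        rcases List.prefix_concat_iff.1 hp with rfl | hp
        · exact absurd hi h
        · exact ⟨τ, hp, hi, hs⟩
  let B : List X → Finset S := fun σ =>
    univ.filter fun s => ∃ τ, τ <+: σ ∧ s ∈ A (j τ) τ ∪ T (j τ)
  refine ⟨B, ⟨?_, ?_⟩, ?_⟩
  · intro σ x s hs
    simp only [B, mem_filter, mem_univ, true_and] at hs ⊢
    obtain ⟨τ, hp, hs⟩ := hs
    exact ⟨τ, hp.trans (List.prefix_append _ _), hs⟩
  · intro σ
    refine P.feas_mono _ _ _ _ (hfeas (j σ) σ) (Finset.Subset.refl _) ?_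
    intro s hs
    simp only [B, mem_filter, mem_univ, true_and]
    exact ⟨σ, List.prefix_rfl, hs⟩
  · intro σ
    have hF : ∀ i, P.setCost (E i σ ∪ T i) ≤ 2 * (δ * 2 ^ i) := by
      intro i
      have := P.setCost_union (E i σ) (T i)
      have := hE i σ
      have := hT i
      linarith
    have hsub : B σ ⊆ (range (j σ + 1)).biUnion fun i => E i σ ∪ T i := by
      intro s hs
      simp only [B, mem_filter, mem_univ, true_and] at hs
      obtain ⟨τ, hp, hs⟩ := hs
      rw [mem_biUnion]
      refine ⟨j τ, mem_range.2 (Nat.lt_succ_of_le (hjmono _ _ hp)), ?_⟩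
      rw [mem_union] at hs ⊢
      refine hs.imp (fun h => ?_) id
      simp only [E, mem_filter, mem_univ, true_and]
      exact ⟨τ, hp, rfl, h⟩
    have hc := P.setCost_mono hsub
    rcases Nat.eq_zero_or_pos (j σ) with h0 | hpos
    · left
      rw [h0] at hc
      have := hF 0
      simp only [zero_add, range_one, singleton_biUnion] at hc
      simp only [pow_zero, mul_one] at this
      linarith
    · right
      obtain ⟨n, hn⟩ := Nat.exists_eq_succ_of_ne_zero hpos.ne'
      refine ⟨n, hjm σ n (by omega), ?_⟩
      have := P.setCost_biUnion_le δ _ hF hδ (j σ)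
      have e : δ * 2 ^ (j σ) = 2 * (δ * 2 ^ n) := by rw [hn, Nat.succ_eq_add_one]; ring
      rw [e] at this
      linarith

end CoveringProblem

theorem stmt1 :
    ∃ C : ℝ, 0 < C ∧
      ∀ (X S : Type) [DecidableEq X] [Fintype S] [DecidableEq S]
        (P : CoveringProblem X S) (α γ : ℝ), 1 ≤ α → 1 ≤ γ → P.Decomposable α γ →
        ∀ ρ : ℕ → ℝ,
        (∀ t, 1 ≤ ρ t) → Monotone ρ → (∀ t, 1 ≤ t → ρ (2 * t) ≤ 2 * ρ t) →
        ∀ ALG : List X → Finset S, P.IsOnlineAlg ALG → P.IsCompetitive ρ ALG →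
        ∀ Xhat : Finset X,
          ∃ B : List X → Finset S, P.IsOnlineAlg B ∧
            ∀ σ : List X, σ.Nodup → 1 ≤ σ.length →
              P.setCost (B σ) ≤
                C * (ρ (predErr Xhat σ) + gFun α γ σ.length) * P.optCost σ.toFinset := by
  refine ⟨8, by norm_num, ?_⟩
  intro X S _ _ _ P α γ hα hγ hd ρ hρ1 hρm _ ALG hA hcomp Xhat
  obtain ⟨δ, hδ, hgap⟩ := P.exists_gap
  choose D T hDR hG hTc hmax using
    fun i : ℕ => P.exists_max Xhat (δ * 2 ^ i) (by positivity)
  obtain ⟨B, hB, hcost⟩ := P.combine δ hδ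
    (fun i σ => ALG (σ.filter fun x => x ∉ D i)) T
    (by
      intro i σ x
      simp only [List.filter_append]
      exact hA.mono _ _)
    (by
      intro i σ
      refine P.feas_mono _ _ _ _ (hG i _ _ (hA.2 (σ.filter fun x => x ∉ D i))) ?_
        (Finset.Subset.refl _)
      intro x hx
      by_cases h : x ∈ D i <;> simp_all)
    hTc
  refine ⟨B, hB, fun σ hσ hk => ?_⟩
  have hcard : σ.toFinset.card = σ.length := List.toFinset_card_of_nodup hσ
  have ho := P.optCost_nonneg σ.toFinset
  have hρ0 : 0 ≤ ρ (predErr Xhat σ) := by linarith [hρ1 (predErr Xhat σ)]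
  obtain ⟨D', T', hD', hG', hc', hle'⟩ := P.decomp hα hγ hd Xhat σ.toFinset (by omega)
  rw [hcard] at hc'
  have hg0 : 0 ≤ gFun α γ σ.length := by
    unfold gFun
    split_ifs with h1
    · linarith
    · have hγ1 : 1 < γ := lt_of_le_of_ne hγ (Ne.symm h1)
      have hq1 : 1 < γ / (γ - 1) := by rw [lt_div_iff₀ (by linarith)]; linarith
      have hlq := Real.log_pos hq1
      have hlk : 0 ≤ Real.log σ.length := Real.log_nonneg (by exact_mod_cast hk)
      positivity
  have hp1 := mul_nonneg hρ0 ho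
  have hp2 := mul_nonneg hg0 ho
  rcases hcost σ with h | ⟨i, hi, hBi⟩
  · rw [hgap _ h]
    nlinarith
  · suffices δ * 2 ^ i ≤ (ρ (predErr Xhat σ) + gFun α γ σ.length) * P.optCost σ.toFinset by
      linarith
    rw [add_mul]
    rcases lt_or_ge (δ * 2 ^ i) (gFun α γ σ.length * P.optCost σ.toFinset) with hlt | hge
    · linarith
    · have hu := (hmax i D' T' hD' hG' (hc'.trans hge)).trans hle'
      have hnd : (σ.filter fun x => x ∉ D i).Nodup := hσ.filter _
      have h1 := hcomp _ hnd
      have hfs : (σ.filter fun x => x ∉ D i).toFinset = σ.toFinset \ D i := by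
        ext x; simp
      have hlen : (σ.filter fun x => x ∉ D i).length ≤ predErr Xhat σ := by
        rw [← List.toFinset_card_of_nodup hnd, hfs]
        refine le_min (Finset.card_le_card Finset.sdiff_subset) ?_
        have hsub : σ.toFinset \ D i ⊆ (σ.toFinset \ Xhat) ∪ (Xhat \ D i) := by
          intro x; simp only [mem_sdiff, mem_union]; tauto
        have := (Finset.card_le_card hsub).trans (Finset.card_union_le _ _)
        omega
      have h2 : P.optCost (σ.filter fun x => x ∉ D i).toFinset ≤ P.optCost σ.toFinset := by
        rw [hfs]; exact P.optCost_mono Finset.sdiff_subset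
      have h3 := mul_le_mul (hρm hlen) h2 (P.optCost_nonneg _) hρ0
      linarith
end
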